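/- Let K be a field, σ a type, and S = MvPolynomial σ K. Let Γ ⊆ σ be a set of variable indices and P ⊆ S a set of polynomials such that no variable from Γ occurs in any polynomial of P. Then the intersection of the ideal generated by the variables {X_γ : γ ∈ Γ} with the ideal generated by P equals the ideal generated by the set of products { X_γ · f : γ ∈ Γ, f ∈ P }. -/

import Mathlib

open MvPolynomial

namespace MvPolynomial

variable {R σ : Type*} [CommRing R]

open Classical in
/-- The endomorphism of the polynomial ring that sends the variables indexed by `Γ` to zero and
fixes the others. -/
noncomputable def killVars (Γ : Set σ) : MvPolynomial σ R →ₐ[R] MvPolynomial σ R :=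
  aeval fun i => if i ∈ Γ then 0 else X i

theorem killVars_X_of_mem {Γ : Set σ} {i : σ} (hi : i ∈ Γ) :
    killVars Γ (X i : MvPolynomial σ R) = 0 := by
  simp [killVars, hi]

theorem killVars_X_of_notMem {Γ : Set σ} {i : σ} (hi : i ∉ Γ) :
    killVars Γ (X i : MvPolynomial σ R) = X i := by
  simp [killVars, hi]

theorem killVars_eq_self {Γ : Set σ} {f : MvPolynomial σ R} (hf : ∀ γ ∈ Γ, γ ∉ f.vars) :
    killVars Γ f = f :=
  hom_congr_vars (f₁ := (killVars Γ : MvPolynomial σ R →ₐ[R] MvPolynomial σ R).toRingHom)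
    (f₂ := RingHom.id _) (by ext; simp [← algebraMap_eq])
    (fun i hi _ => killVars_X_of_notMem fun h => hf i h hi) rfl

theorem killVars_eq_zero_of_mem_span {Γ : Set σ} {p : MvPolynomial σ R}
    (hp : p ∈ Ideal.span (X '' Γ)) : killVars Γ p = 0 := by
  have h : Ideal.span (X '' Γ) ≤
      RingHom.ker (killVars Γ : MvPolynomial σ R →ₐ[R] MvPolynomial σ R) := by
    rw [Ideal.span_le]
    rintro _ ⟨i, hi, rfl⟩
    exact killVars_X_of_mem hi
  exact h hp

theorem sub_killVars_mem_span (Γ : Set σ) (p : MvPolynomial σ R) :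
    p - killVars Γ p ∈ Ideal.span (X '' Γ) := by
  rw [← Ideal.Quotient.mk_eq_mk_iff_sub_mem]
  suffices h : Ideal.Quotient.mkₐ R (Ideal.span (X '' Γ)) =
      (Ideal.Quotient.mkₐ R (Ideal.span (X '' Γ))).comp (killVars Γ) from
    DFunLike.congr_fun h p
  ext i
  by_cases hi : i ∈ Γ
  · simpa [killVars_X_of_mem hi, Ideal.Quotient.eq_zero_iff_mem] using
      Ideal.subset_span (Set.mem_image_of_mem X hi)
  · simp [killVars_X_of_notMem hi]

theorem sub_killVars_mem_span_mul_span {Γ : Set σ} {P : Set (MvPolynomial σ R)}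
    (hvars : ∀ f ∈ P, ∀ γ ∈ Γ, γ ∉ f.vars) {g : MvPolynomial σ R} (hg : g ∈ Ideal.span P) :
    g - killVars Γ g ∈ Ideal.span (X '' Γ) * Ideal.span P := by
  induction hg using Submodule.closure_induction with
  | zero => simp
  | add p q _ _ hp hq =>
    rw [map_add, add_sub_add_comm]
    exact add_mem hp hq
  | smul_mem a f hf =>
    rw [smul_eq_mul, map_mul, killVars_eq_self (hvars f hf), ← sub_mul]
    exact Ideal.mul_mem_mul (sub_killVars_mem_span Γ a) (Ideal.subset_span hf)

theorem span_X_inf_span_eq_mul {Γ : Set σ} {P : Set (MvPolynomial σ R)}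
    (hvars : ∀ f ∈ P, ∀ γ ∈ Γ, γ ∉ f.vars) :
    Ideal.span (X '' Γ) ⊓ Ideal.span P = Ideal.span (X '' Γ) * Ideal.span P := by
  refine le_antisymm (fun g hg => ?_) Ideal.mul_le_inf
  simpa [killVars_eq_zero_of_mem_span hg.1] using sub_killVars_mem_span_mul_span hvars hg.2

end MvPolynomial

/-- If no variable from `Γ` occurs in any polynomial of `P`, then the
intersection of the ideal generated by the variables indexed by `Γ` with the ideal
generated by `P` is the ideal generated by the products `X γ * f`, `γ ∈ Γ`, `f ∈ P`. -/
theorem ferrer_span_vars_inf_span {K : Type*} [Field K] {σ : Type*}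
    (Γ : Set σ) (P : Set (MvPolynomial σ K))
    (hvars : ∀ f ∈ P, ∀ γ ∈ Γ, γ ∉ f.vars) :
    Ideal.span (X '' Γ) ⊓ Ideal.span P =
      Ideal.span {g : MvPolynomial σ K | ∃ γ ∈ Γ, ∃ f ∈ P, g = X γ * f} := by
  rw [span_X_inf_span_eq_mul hvars, Ideal.span_mul_span']
  congr 1
  ext g
  simp [Set.mem_mul, eq_comm]
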